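/- For every integer r ≥ 25, a_r' − a_r ≤ 2.5·10^{−4} · 1.45^{−r+25}. -/

import Mathlib

open Filter Real

/-- `fTail ℓ x = e^x − ∑_{i=0}^{ℓ−1} x^i/i!`. -/
noncomputable def fTail (ℓ : ℕ) (x : ℝ) : ℝ :=
  Real.exp x - ∑ i ∈ Finset.range ℓ, x ^ i / (Nat.factorial i : ℝ)

/-- `truncMean ℓ x` is the mean of a Poisson(x) random variable conditioned on
being at least `ℓ`. -/
noncomputable def truncMean (ℓ : ℕ) (x : ℝ) : ℝ :=
  (∑' i : ℕ, if ℓ ≤ i then (i : ℝ) * x ^ i / (Nat.factorial i : ℝ) else 0) /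
  (∑' i : ℕ, if ℓ ≤ i then x ^ i / (Nat.factorial i : ℝ) else 0)

/-- `qProb ℓ r x = r·Pr(Po_{≥ℓ}(x) = r)/λ_ℓ(x)` for `r ≥ ℓ`, and `0` otherwise. -/
noncomputable def qProb (ℓ r : ℕ) (x : ℝ) : ℝ :=
  if ℓ ≤ r then (r : ℝ) * (x ^ r / ((Nat.factorial r : ℝ) * fTail ℓ x)) / truncMean ℓ x
  else 0

/-- `aAux ar r` is the quantity `a_r'`, the supremum over `λ > 0` of
`a_r − g(r,λ)/λ_{r+1} + (0.55·λ_1/((1.55^{max(r,3)} − 1)·λ_{r+1}))·[(r+1)q_{r+1,r+1} − r·q_{r,r}]`. -/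
noncomputable def aAux (ar : ℝ) (r : ℕ) : ℝ :=
  sSup {z : ℝ | ∃ l : ℝ, 0 < l ∧
    z = ar - (ar * truncMean (r + 1) l - (ar + 1) * truncMean r l + truncMean (r - 1) l) /
          truncMean (r + 1) l
        + (0.55 * truncMean 1 l / (((1.55 : ℝ) ^ (max r 3) - 1) * truncMean (r + 1) l)) *
            (((r : ℝ) + 1) * qProb (r + 1) (r + 1) l - (r : ℝ) * qProb r r l)}

/-- The recursively defined constants `a_r`: `a_2 = 1.55`, and
`a_{r+1} = max{a_r, a_r'} + 10^{−5}` for `2 ≤ r ≤ 24`,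
`a_{r+1} = max{a_r, a_r'} + 2^{−r}` for `r ≥ 25`. -/
noncomputable def aSeq : ℕ → ℝ
  | 0 => 1.55
  | 1 => 1.55
  | 2 => 1.55
  | (r + 3) =>
      max (aSeq (r + 2)) (aAux (aSeq (r + 2)) (r + 2)) +
        (if r + 2 ≤ 24 then 1e-5 else ((2 : ℝ)⁻¹) ^ (r + 2))

lemma hasSum_fTail (ℓ : ℕ) (x : ℝ) :
    HasSum (fun i : ℕ => if ℓ ≤ i then x ^ i / (Nat.factorial i : ℝ) else 0) (fTail ℓ x) := by
  have hexp : HasSum (fun i : ℕ => x ^ i / (Nat.factorial i : ℝ)) (Real.exp x) := by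
    rw [Real.exp_eq_exp_ℝ]
    exact NormedSpace.expSeries_div_hasSum_exp x
  have hfin : HasSum (fun i : ℕ => if i < ℓ then x ^ i / (Nat.factorial i : ℝ) else 0)
      (∑ i ∈ Finset.range ℓ, if i < ℓ then x ^ i / (Nat.factorial i : ℝ) else 0) :=
    hasSum_sum_of_ne_finset_zero fun i hi => if_neg (by simpa using hi)
  rw [Finset.sum_congr rfl fun i hi => if_pos (Finset.mem_range.mp hi)] at hfin
  refine (hexp.sub hfin).congr_fun fun i => ?_
  by_cases h : ℓ ≤ i
  · simp [h, not_lt.mpr h]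
  · simp [h, not_le.mp h]

lemma hasSum_mul_fTail (k : ℕ) (x : ℝ) :
    HasSum (fun i : ℕ => if k + 1 ≤ i then (i : ℝ) * x ^ i / (Nat.factorial i : ℝ) else 0)
      (x * fTail k x) := by
  rw [← hasSum_nat_add_iff' 1]
  simp only [Finset.range_one, Finset.sum_singleton, nonpos_iff_eq_zero, Nat.add_eq_zero_iff,
    one_ne_zero, and_false, if_false, sub_zero]
  refine ((hasSum_fTail k x).mul_left x).congr_fun fun i => ?_
  by_cases h : k ≤ i
  · have : (i : ℝ) + 1 ≠ 0 := by positivity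
    simp only [h, add_le_add_iff_right, if_true, Nat.factorial_succ]
    push_cast
    field_simp
    ring
  · simp [h]

lemma fTail_eq_add (k : ℕ) (x : ℝ) :
    fTail k x = fTail (k + 1) x + x ^ k / (Nat.factorial k : ℝ) := by
  rw [fTail, fTail, Finset.sum_range_succ]
  ring

lemma fTail_pos (k : ℕ) {x : ℝ} (hx : 0 < x) : 0 < fTail k x := by
  have h : 0 ≤ fTail (k + 1) x := (hasSum_fTail (k + 1) x).nonneg fun i => by
    split_ifs <;> positivity
  rw [fTail_eq_add]
  positivity

lemma truncMean_succ (k : ℕ) (x : ℝ) :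
    truncMean (k + 1) x = x * fTail k x / fTail (k + 1) x := by
  rw [truncMean, (hasSum_mul_fTail k x).tsum_eq, (hasSum_fTail (k + 1) x).tsum_eq]

lemma le_truncMean {ℓ : ℕ} (hℓ : 1 ≤ ℓ) {x : ℝ} (hx : 0 < x) : (ℓ : ℝ) ≤ truncMean ℓ x := by
  obtain ⟨k, rfl⟩ := Nat.exists_eq_add_of_le' hℓ
  rw [truncMean_succ, le_div_iff₀ (fTail_pos _ hx)]
  refine hasSum_le (fun i => ?_) ((hasSum_fTail (k + 1) x).mul_left _) (hasSum_mul_fTail k x)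
  by_cases h : k + 1 ≤ i
  · simp only [h, if_true, mul_div_assoc]
    have : ((k + 1 : ℕ) : ℝ) ≤ i := by exact_mod_cast h
    gcongr
  · simp [h]

lemma truncMean_pos {ℓ : ℕ} (hℓ : 1 ≤ ℓ) {x : ℝ} (hx : 0 < x) : 0 < truncMean ℓ x :=
  lt_of_lt_of_le (by exact_mod_cast hℓ) (le_truncMean hℓ hx)

lemma self_le_truncMean {ℓ : ℕ} (hℓ : 1 ≤ ℓ) {x : ℝ} (hx : 0 < x) : x ≤ truncMean ℓ x := by
  obtain ⟨k, rfl⟩ := Nat.exists_eq_add_of_le' hℓ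
  have h : 0 ≤ x ^ k / (Nat.factorial k : ℝ) := by positivity
  rw [truncMean_succ, le_div_iff₀ (fTail_pos _ hx), fTail_eq_add k]
  gcongr
  linarith

/-- The recursion linking consecutive truncated means. -/
lemma truncMean_mul_truncMean_succ {ℓ : ℕ} (hℓ : 1 ≤ ℓ) {x : ℝ} (hx : 0 < x) :
    (ℓ + x - truncMean ℓ x) * truncMean (ℓ + 1) x = ℓ * x := by
  obtain ⟨k, rfl⟩ := Nat.exists_eq_add_of_le' hℓ
  have h1 := (fTail_pos (k + 1) hx).ne'
  have h2 := (fTail_pos (k + 2) hx).ne'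
  have hk : x * (x ^ k / (Nat.factorial k : ℝ)) =
      (k + 1) * (fTail (k + 1) x - fTail (k + 2) x) := by
    have : (k : ℝ) + 1 ≠ 0 := by positivity
    rw [fTail_eq_add (k + 1), Nat.factorial_succ]
    push_cast
    field_simp
    ring
  rw [truncMean_succ (k + 1), truncMean_succ k, fTail_eq_add k, mul_add, hk]
  push_cast
  field_simp
  ring

lemma truncMean_le_succ {ℓ : ℕ} (hℓ : 1 ≤ ℓ) {x : ℝ} (hx : 0 < x) :
    truncMean ℓ x ≤ truncMean (ℓ + 1) x := by
  have hrec := truncMean_mul_truncMean_succ hℓ hx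
  have hpos := truncMean_pos (Nat.le_add_left 1 ℓ) hx
  have hℓ0 : (0 : ℝ) < ℓ := by exact_mod_cast hℓ
  have hD : 0 < ℓ + x - truncMean ℓ x :=
    pos_of_mul_pos_left (hrec ▸ mul_pos hℓ0 hx) hpos.le
  refine le_of_mul_le_mul_left ?_ hD
  rw [hrec]
  nlinarith [mul_nonneg (sub_nonneg.mpr (le_truncMean hℓ hx))
    (sub_nonneg.mpr (self_le_truncMean hℓ hx))]

lemma truncMean_one_le {ℓ : ℕ} (hℓ : 1 ≤ ℓ) {x : ℝ} (hx : 0 < x) :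
    truncMean 1 x ≤ truncMean ℓ x := by
  induction ℓ, hℓ using Nat.le_induction with
  | base => exact le_rfl
  | succ n hn ih => exact ih.trans (truncMean_le_succ hn hx)

lemma truncMean_sub_eq {ℓ : ℕ} (hℓ : 1 ≤ ℓ) {x : ℝ} (hx : 0 < x) :
    truncMean ℓ x - ℓ = x * (1 + (truncMean (ℓ + 1) x - (ℓ + 1 : ℕ))) /
      (ℓ + 1 + (truncMean (ℓ + 1) x - (ℓ + 1 : ℕ))) := by
  have hpos := truncMean_pos (Nat.le_add_left 1 ℓ) hx
  push_cast
  rw [add_sub_cancel, eq_div_iff hpos.ne']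
  linear_combination -truncMean_mul_truncMean_succ hℓ hx

/-- One step of the downward induction bounding the mean excess from below. -/
lemma excess_quadratic_step {c r x t : ℝ} (hc : 1 ≤ c) (hr : 0 < r) (hx : 0 < x) (ht : 0 ≤ t)
    (h : 0 ≤ (c + 1) * t ^ 2 + (c * (r + 1) + 1 - x) * t - x) :
    0 ≤ (c + 1) * (x * (1 + t) / (r + 1 + t)) ^ 2 +
      (c * r + 1 - x) * (x * (1 + t) / (r + 1 + t)) - x := by
  have hd : 0 < r + 1 + t := by positivity
  have key : (c + 1) * (x * (1 + t) / (r + 1 + t)) ^ 2 +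
      (c * r + 1 - x) * (x * (1 + t) / (r + 1 + t)) - x =
      x / (r + 1 + t) ^ 2 * (x * ((1 + t) * (c * (1 + t) - r)) +
        (r + 1 + t) * r * (c - 1 + c * t)) := by
    field_simp
    ring
  rw [key]
  have hc1 : 0 ≤ c - 1 := by linarith
  refine mul_nonneg (by positivity) ?_
  have h2 : 0 ≤ (r + 1 + t) * r * (c - 1 + c * t) := by positivity
  rcases le_total 0 (c * (1 + t) - r) with hs | hs
  · have : 0 ≤ x * ((1 + t) * (c * (1 + t) - r)) := by positivity
    linarith
  · have h3 : x * (1 + t) ≤ t * ((c + 1) * t + c * (r + 1) + 1) := by linarith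
    have h4 := mul_le_mul_of_nonpos_right h3 hs
    have h5 : 0 ≤ t * ((c + 1) * t + c * (r + 1) + 1) * (c * (1 + t) - r) +
        (r + 1 + t) * r * (c - 1 + c * t) := by
      have e : t * ((c + 1) * t + c * (r + 1) + 1) * (c * (1 + t) - r) +
          (r + 1 + t) * r * (c - 1 + c * t) =
          r * (r + 1) * (c - 1) + (r * (c - 1) * (c + 2) + c ^ 2 + c) * t +
          (2 * c ^ 2 + 2 * c + r * (c - 1) * (c + 1)) * t ^ 2 + (c + 1) * c * t ^ 3 := by ring
      rw [e]
      positivity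
    linarith

/-- A quadratic lower bound for the mean excess `truncMean ℓ x - ℓ`. -/
lemma excess_quadratic_nonneg {c : ℝ} (hc : 1 < c) {ℓ : ℕ} (hℓ : 1 ≤ ℓ) {x : ℝ} (hx : 0 < x) :
    0 ≤ (c + 1) * (truncMean ℓ x - ℓ) ^ 2 + (c * ℓ + 1 - x) * (truncMean ℓ x - ℓ) - x := by
  have hc1 : 0 < c - 1 := by linarith
  obtain ⟨N, hN⟩ := exists_nat_ge (x / (c - 1))
  rw [div_le_iff₀ hc1] at hN
  have hexc : ∀ {n : ℕ}, 1 ≤ n → 0 ≤ truncMean n x - n := fun hn =>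
    sub_nonneg.mpr (le_truncMean hn hx)
  induction hd : N - ℓ generalizing ℓ with
  | zero =>
    have hNℓ : (N : ℝ) ≤ ℓ := by exact_mod_cast (show N ≤ ℓ by omega)
    have hxl : x ≤ (c - 1) * ℓ := by nlinarith
    have hs := hexc hℓ
    have hle : x / (ℓ + 1) ≤ truncMean ℓ x - ℓ := by
      have ht := hexc (Nat.le_add_left 1 ℓ)
      rw [truncMean_sub_eq hℓ hx]
      set t := truncMean (ℓ + 1) x - (ℓ + 1 : ℕ)
      rw [div_le_div_iff₀ (by positivity) (by positivity)]
      have : 0 ≤ x * t * ℓ := by positivity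
      nlinarith
    rw [div_le_iff₀ (by positivity)] at hle
    have h1 : 0 ≤ ((c - 1) * ℓ - x) * (truncMean ℓ x - ℓ) :=
      mul_nonneg (by linarith) hs
    have h2 : 0 ≤ (c + 1) * (truncMean ℓ x - ℓ) ^ 2 := by positivity
    linarith
  | succ d ih =>
    have ht := hexc (Nat.le_add_left 1 ℓ)
    have h := ih (Nat.le_add_left 1 ℓ) (by omega)
    rw [truncMean_sub_eq hℓ hx]
    push_cast at h ht ⊢
    exact excess_quadratic_step hc.le (by exact_mod_cast hℓ) hx ht h

/-- Increments of the truncated mean shrink by at most a factor `c > 1`. -/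
lemma truncMean_increment_le {c : ℝ} (hc : 1 < c) {ℓ : ℕ} (hℓ : 1 ≤ ℓ) {x : ℝ} (hx : 0 < x) :
    truncMean (ℓ + 1) x - truncMean ℓ x ≤ c * (truncMean (ℓ + 2) x - truncMean (ℓ + 1) x) := by
  have hq := excess_quadratic_nonneg hc (Nat.le_add_left 1 ℓ) hx
  have hr1 := truncMean_mul_truncMean_succ hℓ hx
  have hr2 := truncMean_mul_truncMean_succ (Nat.le_add_left 1 ℓ) hx
  have hy := truncMean_pos (Nat.le_add_left 1 ℓ) hx
  have hz := truncMean_pos (Nat.le_add_left 1 (ℓ + 1)) hx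
  have hyx := self_le_truncMean (Nat.le_add_left 1 ℓ) hx
  push_cast at hq hr2
  rw [show ℓ + 1 + 1 = ℓ + 2 from rfl] at hr2 hz
  set w := truncMean ℓ x
  set y := truncMean (ℓ + 1) x
  set z := truncMean (ℓ + 2) x
  have hD : 0 < (ℓ : ℝ) + 1 + x - y :=
    pos_of_mul_pos_left (hr2 ▸ by positivity) hz.le
  refine le_of_mul_le_mul_left ?_ (mul_pos hy hD)
  have e1 : y * ((ℓ : ℝ) + 1 + x - y) * (y - w) =
      (y - ℓ) * (y - x) * ((ℓ : ℝ) + 1 + x - y) := by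
    linear_combination ((ℓ : ℝ) + 1 + x - y) * hr1
  have e2 : y * ((ℓ : ℝ) + 1 + x - y) * (c * (z - y)) =
      c * y * ((y - (ℓ + 1)) * (y - x)) := by
    linear_combination c * y * hr2
  rw [e1, e2]
  have := mul_nonneg (sub_nonneg.mpr hyx) hq
  linarith

lemma qProb_self_nonneg {n : ℕ} (hn : 1 ≤ n) {x : ℝ} (hx : 0 < x) : 0 ≤ qProb n n x := by
  have := truncMean_pos hn hx
  have := fTail_pos n hx
  rw [qProb, if_pos le_rfl]
  positivity

lemma qProb_self_le_one {n : ℕ} (hn : 1 ≤ n) {x : ℝ} (hx : 0 < x) : qProb n n x ≤ 1 := by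
  obtain ⟨k, rfl⟩ := Nat.exists_eq_add_of_le' hn
  have hk := fTail_pos k hx
  have hk1 := fTail_pos (k + 1) hx
  have h : x ^ k / (Nat.factorial k : ℝ) ≤ fTail k x := by
    rw [fTail_eq_add k]
    linarith
  have e : qProb (k + 1) (k + 1) x = x ^ k / (Nat.factorial k : ℝ) / fTail k x := by
    have : (k : ℝ) + 1 ≠ 0 := by positivity
    rw [qProb, if_pos le_rfl, truncMean_succ, Nat.factorial_succ]
    push_cast
    field_simp
    ring
  rw [e, div_le_one hk]
  exact h

lemma le_aSeq (r : ℕ) : 1.55 ≤ aSeq r := by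
  induction r with
  | zero => simp [aSeq]
  | succ n ih =>
    match n with
    | 0 => simp [aSeq]
    | 1 => simp [aSeq]
    | n + 2 =>
      rw [aSeq]
      have h : (0 : ℝ) ≤ if n + 2 ≤ 24 then 1e-5 else ((2 : ℝ)⁻¹) ^ (n + 2) := by
        split_ifs <;> positivity
      linarith [le_max_left (aSeq (n + 2)) (aAux (aSeq (n + 2)) (n + 2))]

lemma correction_le (n : ℕ) :
    0.55 * (n + 26 : ℝ) * 1.45 ^ n ≤ 2.5e-4 * ((1.55 : ℝ) ^ (n + 25) - 1) := by
  induction n with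
  | zero => norm_num
  | succ n ih =>
    rw [show n + 1 + 25 = (n + 25) + 1 by ring, pow_succ (1.55 : ℝ), pow_succ (1.45 : ℝ)]
    push_cast
    have hn : (0 : ℝ) ≤ n := by positivity
    have hp : (0 : ℝ) < 1.45 ^ n := by positivity
    have : 0.55 * (n + 1 + 26 : ℝ) * 1.45 * 1.45 ^ n ≤
        1.55 * (0.55 * (n + 26 : ℝ)) * 1.45 ^ n :=
      mul_le_mul_of_nonneg_right (by linarith) hp.le
    linarith

lemma aAux_sub_le {a : ℝ} (ha : 1.55 ≤ a) {r : ℕ} (hr : 3 ≤ r) :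
    aAux a r - a ≤ 0.55 * (r + 1) / ((1.55 : ℝ) ^ r - 1) := by
  rw [sub_le_iff_le_add, aAux]
  refine csSup_le ⟨_, 1, one_pos, rfl⟩ ?_
  rintro z ⟨x, hx, rfl⟩
  rw [max_eq_left hr]
  obtain ⟨k, rfl⟩ := Nat.exists_eq_add_of_le' (show 1 ≤ r by omega)
  have hinc := truncMean_increment_le (c := a) (by norm_num at ha ⊢; linarith)
    (show 1 ≤ k by omega) hx
  have hone := truncMean_one_le (ℓ := k + 2) (by omega) hx
  have hpos := truncMean_pos (ℓ := k + 2) (by omega) hx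
  have h1 := truncMean_pos le_rfl hx
  have hq1 := qProb_self_le_one (n := k + 2) (by omega) hx
  have hq0 := qProb_self_nonneg (n := k + 1) (by omega) hx
  have hpow : 0 < (1.55 : ℝ) ^ (k + 1) - 1 :=
    sub_pos.mpr (one_lt_pow₀ (by norm_num) (by omega))
  rw [Nat.add_sub_cancel, show k + 1 + 1 = k + 2 from rfl]
  push_cast
  have hg : 0 ≤ (a * truncMean (k + 2) x - (a + 1) * truncMean (k + 1) x + truncMean k x) /
      truncMean (k + 2) x := div_nonneg (by linarith) hpos.le
  have hbr : ((k : ℝ) + 1 + 1) * qProb (k + 2) (k + 2) x -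
      ((k : ℝ) + 1) * qProb (k + 1) (k + 1) x ≤ (k : ℝ) + 1 + 1 := by
    have : 0 ≤ ((k : ℝ) + 1) * qProb (k + 1) (k + 1) x := by positivity
    have : ((k : ℝ) + 1 + 1) * qProb (k + 2) (k + 2) x ≤ ((k : ℝ) + 1 + 1) * 1 := by gcongr
    linarith
  have hK : 0.55 * truncMean 1 x / (((1.55 : ℝ) ^ (k + 1) - 1) * truncMean (k + 2) x) ≤
      0.55 / ((1.55 : ℝ) ^ (k + 1) - 1) := by
    rw [div_le_div_iff₀ (by positivity) hpow]
    have := mul_le_mul_of_nonneg_right hone hpow.le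
    linarith
  have hfin := (mul_le_mul_of_nonneg_left hbr (by positivity :
      0 ≤ 0.55 * truncMean 1 x / (((1.55 : ℝ) ^ (k + 1) - 1) * truncMean (k + 2) x))).trans
    (mul_le_mul_of_nonneg_right hK (by positivity : 0 ≤ (k : ℝ) + 1 + 1))
  rw [mul_div_right_comm 0.55 ((k : ℝ) + 1 + 1)]
  linarith

/-- For every `r ≥ 25`, `a_r' − a_r ≤ 2.5·10^{−4}·1.45^{−r+25}`. -/
theorem stmt_18 (r : ℕ) (hr : 25 ≤ r) :
    aAux (aSeq r) r - aSeq r ≤ 2.5e-4 * (1.45 : ℝ) ^ ((25 : ℤ) - (r : ℤ)) := by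
  refine (aAux_sub_le (le_aSeq r) (by omega)).trans ?_
  obtain ⟨n, rfl⟩ := Nat.exists_eq_add_of_le' hr
  have hpow : 0 < (1.55 : ℝ) ^ (n + 25) - 1 :=
    sub_pos.mpr (one_lt_pow₀ (by norm_num) (by omega))
  have e : (25 : ℤ) - ((n + 25 : ℕ) : ℤ) = -(n : ℤ) := by
    push_cast
    ring
  rw [e, zpow_neg, zpow_natCast, ← div_eq_mul_inv, div_le_div_iff₀ hpow (by positivity)]
  have := correction_le n
  push_cast
  linarith
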